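/- Assume Condition (C). Let p and q both belong to (C^{1+α/4,2+α/2}([0,T]×ℝ))^N and both be solutions of the system (SPDE) on [0,T] with the same initial data P = (P_n) and the same masses (m_n). Then p = q on [0,T]×ℝ. -/

import Mathlib

open Finset MeasureTheory

/-- `f_max`. -/
noncomputable def fmax (N : ℕ) (f : Fin N → ℝ) : ℝ := ⨆ n, f n

/-- `f_min`. -/
noncomputable def fmin (N : ℕ) (f : Fin N → ℝ) : ℝ := ⨅ n, f n

/-- `f̄ = (1/N) Σ_n f(n)`. -/
noncomputable def fbar (N : ℕ) (f : Fin N → ℝ) : ℝ := (∑ n, f n) / N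

/-- `β(f) = (f_max − f_min)/f_min + (1/f_min)√(Σ_n (f(n) − f̄)²)`. -/
noncomputable def betaf (N : ℕ) (f : Fin N → ℝ) : ℝ :=
  (fmax N f - fmin N f) / fmin N f +
    (1 / fmin N f) * Real.sqrt (∑ n, (f n - fbar N f) ^ 2)

/-- `κ₀ = (1/2)[N + 1 − max_k √((Σ_{n≠k} f(n))(Σ_{n≠k} 1/f(n)))]`. -/
noncomputable def kappa0 (N : ℕ) (f : Fin N → ℝ) : ℝ :=
  (1 / 2) * (N + 1 -
    ⨆ k : Fin N, Real.sqrt ((∑ n ∈ univ.erase k, f n) * ∑ n ∈ univ.erase k, (f n)⁻¹))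

/-- Membership in the parabolic Hölder space `C^{1+γ/2,2+γ}([0,T]×ℝ)` (case `k = 2` of the
spaces `H^{(k+γ)/2,k+γ}`): the derivatives `∂_x φ`, `∂_x² φ`, `∂_t φ` exist, all of
`φ, ∂_x φ, ∂_x² φ, ∂_t φ` are bounded on `[0,T]×ℝ`, `∂_x φ` is `(1+γ)/2`-Hölder in time,
`∂_x² φ` and `∂_t φ` are `γ/2`-Hölder in time and `γ`-Hölder in space. -/
def MemParabHolder (γ T : ℝ) (φ : ℝ → ℝ → ℝ) : Prop :=
  (∀ t ∈ Set.Icc (0 : ℝ) T, ∀ x : ℝ,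
      DifferentiableAt ℝ (φ t) x ∧ DifferentiableAt ℝ (deriv (φ t)) x ∧
      DifferentiableAt ℝ (fun s => φ s x) t) ∧
  ∃ K : ℝ,
    (∀ t ∈ Set.Icc (0 : ℝ) T, ∀ x : ℝ,
      |φ t x| ≤ K ∧ |deriv (φ t) x| ≤ K ∧ |deriv (deriv (φ t)) x| ≤ K ∧
      |deriv (fun s => φ s x) t| ≤ K) ∧
    (∀ t ∈ Set.Icc (0 : ℝ) T, ∀ s ∈ Set.Icc (0 : ℝ) T, ∀ x : ℝ,
      |deriv (φ t) x - deriv (φ s) x| ≤ K * |t - s| ^ ((1 + γ) / 2) ∧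
      |deriv (deriv (φ t)) x - deriv (deriv (φ s)) x| ≤ K * |t - s| ^ (γ / 2) ∧
      |deriv (fun r => φ r x) t - deriv (fun r => φ r x) s| ≤ K * |t - s| ^ (γ / 2)) ∧
    (∀ t ∈ Set.Icc (0 : ℝ) T, ∀ x y : ℝ,
      |deriv (deriv (φ t)) x - deriv (deriv (φ t)) y| ≤ K * |x - y| ^ γ ∧
      |deriv (fun s => φ s x) t - deriv (fun s => φ s y) t| ≤ K * |x - y| ^ γ)

/-- `B^ε_n(p)(t,x) = (ε + f(n) Σ_k p_k(t,x)) / (ε + Σ_k f(k) p_k(t,x))`. -/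
noncomputable def Bfun (N : ℕ) (f : Fin N → ℝ) (ε : ℝ) (p : Fin N → ℝ → ℝ → ℝ)
    (n : Fin N) (t x : ℝ) : ℝ :=
  (ε + f n * ∑ k, p k t x) / (ε + ∑ k, f k * p k t x)

/-- `p = (p_1,…,p_N)` is a solution of the system (SPDE) on `[0,T]` with initial data `P`
and masses `m`: each `p_n(t,·)` is nonnegative of total mass `m_n`, `p_n(0,·) = P_n`, and
`∂_t p_n = (1/2)∂_xx[σ² B^ε_n(p) p_n] + (1/2)∂_x[σ² B^ε_n(p) p_n]` on `[0,T]×ℝ`. -/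
noncomputable def IsSPDESolution (N : ℕ) (f : Fin N → ℝ) (ε T : ℝ) (σ : ℝ → ℝ → ℝ)
    (m : Fin N → ℝ) (P : Fin N → ℝ → ℝ) (p : Fin N → ℝ → ℝ → ℝ) : Prop :=
  (∀ n, ∀ t ∈ Set.Icc (0 : ℝ) T, (∀ x : ℝ, 0 ≤ p n t x) ∧ Integrable (p n t) ∧
    (∫ x : ℝ, p n t x) = m n) ∧
  (∀ n, ∀ x : ℝ, p n 0 x = P n x) ∧
  (∀ n, ∀ t ∈ Set.Icc (0 : ℝ) T, ∀ x : ℝ,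
    deriv (fun s => p n s x) t =
      (1 / 2) * deriv (deriv fun y => σ t y ^ 2 * Bfun N f ε p n t y * p n t y) x +
      (1 / 2) * deriv (fun y => σ t y ^ 2 * Bfun N f ε p n t y * p n t y) x)

/-- The integrable weight `(1 + x²)⁻¹` used to localise energy estimates on the line. -/
noncomputable def cauchyWeight (x : ℝ) : ℝ := (1 + x ^ 2)⁻¹

lemma cauchyWeight_pos (x : ℝ) : 0 < cauchyWeight x := by
  unfold cauchyWeight; positivity

lemma hasDerivAt_cauchyWeight (x : ℝ) :
    HasDerivAt cauchyWeight (-(2 * x) / (1 + x ^ 2) ^ 2) x := by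
  have h : HasDerivAt (fun y : ℝ => 1 + y ^ 2) (2 * x) x := by
    simpa using ((hasDerivAt_id x).pow 2).const_add 1
  exact h.inv (by positivity)

lemma continuous_cauchyWeight : Continuous cauchyWeight :=
  continuous_iff_continuousAt.2 fun x => (hasDerivAt_cauchyWeight x).continuousAt

lemma abs_deriv_cauchyWeight_le (x : ℝ) : |deriv cauchyWeight x| ≤ cauchyWeight x := by
  rw [(hasDerivAt_cauchyWeight x).deriv, abs_div, abs_of_nonneg (a := (1 + x ^ 2) ^ 2) (by positivity),
    div_le_iff₀ (by positivity)]
  have h : cauchyWeight x * (1 + x ^ 2) ^ 2 = 1 + x ^ 2 := by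
    unfold cauchyWeight; field_simp
  rw [h, abs_le]
  constructor <;> nlinarith [sq_nonneg (x - 1), sq_nonneg (x + 1)]

lemma integrable_cauchyWeight_mul {g : ℝ → ℝ} {M : ℝ} (hg : Measurable g) (hM : ∀ x, |g x| ≤ M) :
    Integrable fun x => cauchyWeight x * g x :=
  integrable_inv_one_add_sq.mul_bdd (c := M) hg.aestronglyMeasurable (ae_of_all _ hM)

lemma integrable_deriv_cauchyWeight_mul {g : ℝ → ℝ} {M : ℝ} (hg : Measurable g)
    (hM : ∀ x, |g x| ≤ M) : Integrable fun x => deriv cauchyWeight x * g x := by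
  refine (integrable_cauchyWeight_mul (g := fun _ => M) measurable_const (fun _ => le_rfl)).mono
    ((measurable_deriv _).mul hg).aestronglyMeasurable (ae_of_all _ fun x => ?_)
  rw [Real.norm_eq_abs, Real.norm_eq_abs, abs_mul, abs_mul, abs_of_pos (cauchyWeight_pos x)]
  exact mul_le_mul (abs_deriv_cauchyWeight_le x) ((hM x).trans (le_abs_self M)) (abs_nonneg _)
    (cauchyWeight_pos x).le

/-- Weighted integration by parts for `½ (W'' + W')` tested against `2 U`. -/
lemma integral_cauchyWeight_mul_div_form {U V W : ℝ → ℝ} {K : ℝ}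
    (hU : Differentiable ℝ U) (hW : ContDiff ℝ 2 W)
    (hUb : ∀ x, |U x| ≤ K) (hU'b : ∀ x, |deriv U x| ≤ K) (hVb : ∀ x, |V x| ≤ K)
    (hW'b : ∀ x, |deriv W x| ≤ K)
    (hV : ∀ x, V x = 1 / 2 * deriv (deriv W) x + 1 / 2 * deriv W x) :
    Integrable (fun x => cauchyWeight x * (2 * U x * V x)) ∧
    Integrable (fun x => cauchyWeight x * (U x * deriv W x - deriv U x * deriv W x) -
      deriv cauchyWeight x * (U x * deriv W x)) ∧
    ∫ x, cauchyWeight x * (2 * U x * V x) =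
      ∫ x, (cauchyWeight x * (U x * deriv W x - deriv U x * deriv W x) -
        deriv cauchyWeight x * (U x * deriv W x)) := by
  have hK : 0 ≤ K := (abs_nonneg _).trans (hUb 0)
  have hWd : Differentiable ℝ (deriv W) := by
    have h : ContDiff ℝ (1 + 1) W := by norm_num; exact hW
    exact (contDiff_one_iff_deriv.1 (contDiff_succ_iff_deriv.1 h).2.2).1
  have mU := hU.continuous.measurable
  have mU' := measurable_deriv U
  have mW' := measurable_deriv W
  have mW'' := measurable_deriv (deriv W)
  have hW''b : ∀ x, |deriv (deriv W) x| ≤ 3 * K := fun x => by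
    have h := hV x
    have h1 := abs_le.1 (hVb x)
    have h2 := abs_le.1 (hW'b x)
    rw [abs_le]; constructor <;> linarith
  have i1 : Integrable fun x => cauchyWeight x * (U x * deriv W x) :=
    integrable_cauchyWeight_mul (M := K * K) (mU.mul mW') fun x => by
      rw [abs_mul]; exact mul_le_mul (hUb x) (hW'b x) (abs_nonneg _) hK
  have i2 : Integrable fun x => cauchyWeight x * (deriv U x * deriv W x) :=
    integrable_cauchyWeight_mul (M := K * K) (mU'.mul mW') fun x => by
      rw [abs_mul]; exact mul_le_mul (hU'b x) (hW'b x) (abs_nonneg _) hK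
  have i3 : Integrable fun x => deriv cauchyWeight x * (U x * deriv W x) :=
    integrable_deriv_cauchyWeight_mul (M := K * K) (mU.mul mW') fun x => by
      rw [abs_mul]; exact mul_le_mul (hUb x) (hW'b x) (abs_nonneg _) hK
  have i4 : Integrable fun x => cauchyWeight x * (U x * deriv (deriv W) x) :=
    integrable_cauchyWeight_mul (M := K * (3 * K)) (mU.mul mW'') fun x => by
      rw [abs_mul]; exact mul_le_mul (hUb x) (hW''b x) (abs_nonneg _) hK
  have hparts := integral_mul_deriv_eq_deriv_mul_of_integrable
    (u := fun x => cauchyWeight x * U x) (v := deriv W)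
    (u' := fun x => deriv cauchyWeight x * U x + cauchyWeight x * deriv U x)
    (v' := deriv (deriv W))
    (fun x _ => (hasDerivAt_cauchyWeight x).differentiableAt.hasDerivAt.mul (hU x).hasDerivAt)
    (fun x _ => (hWd x).hasDerivAt)
    (i4.congr (ae_of_all _ fun x => by simp [mul_assoc]))
    ((i3.add i2).congr (ae_of_all _ fun x => by simp; ring))
    (i1.congr (ae_of_all _ fun x => by simp [mul_assoc]))
  have e1 : (fun x => cauchyWeight x * (2 * U x * V x)) =
      fun x => cauchyWeight x * U x * deriv (deriv W) x + cauchyWeight x * (U x * deriv W x) := by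
    funext x; rw [hV x]; ring
  have i4' : Integrable fun x => cauchyWeight x * U x * deriv (deriv W) x :=
    i4.congr (ae_of_all _ fun x => by simp [mul_assoc])
  have i12 : Integrable fun x => cauchyWeight x * (U x * deriv W x - deriv U x * deriv W x) :=
    (i1.sub i2).congr (ae_of_all _ fun x => by simp; ring)
  have i23 : Integrable fun x => (deriv cauchyWeight x * U x + cauchyWeight x * deriv U x)
      * deriv W x := (i3.add i2).congr (ae_of_all _ fun x => by simp; ring)
  have i23n : Integrable fun x => -((deriv cauchyWeight x * U x + cauchyWeight x * deriv U x)
      * deriv W x) := i23.neg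
  refine ⟨e1 ▸ i4'.add i1, i12.sub i3, ?_⟩
  rw [e1, integral_add i4' i1, hparts, ← integral_neg, ← integral_add i23n i1]
  congr 1; funext x; ring

/-- Dissipativity of a system `∂ₜ Uₙ = ½ (Wₙ'' + Wₙ')` in the weighted energy. -/
lemma integral_cauchyWeight_energy_le {ι : Type*} [Fintype ι] {U V W : ι → ℝ → ℝ} {K C : ℝ}
    (hU : ∀ n, Differentiable ℝ (U n)) (hW : ∀ n, ContDiff ℝ 2 (W n))
    (hUb : ∀ n x, |U n x| ≤ K) (hU'b : ∀ n x, |deriv (U n) x| ≤ K) (hVb : ∀ n x, |V n x| ≤ K)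
    (hW'b : ∀ n x, |deriv (W n) x| ≤ K)
    (hV : ∀ n x, V n x = 1 / 2 * deriv (deriv (W n)) x + 1 / 2 * deriv (W n) x)
    (hdiss : ∀ x, 2 * ∑ n, |U n x| * |deriv (W n) x| - ∑ n, deriv (U n) x * deriv (W n) x ≤
      C * ∑ n, U n x ^ 2) :
    ∫ x, cauchyWeight x * ∑ n, 2 * U n x * V n x ≤
      C * ∫ x, cauchyWeight x * ∑ n, U n x ^ 2 := by
  have key := fun n => integral_cauchyWeight_mul_div_form (hU n) (hW n) (hUb n) (hU'b n) (hVb n)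
    (hW'b n) (hV n)
  have isq : Integrable fun x => cauchyWeight x * ∑ n, U n x ^ 2 := by
    simp_rw [Finset.mul_sum]
    refine integrable_finsetSum _ fun n _ => integrable_cauchyWeight_mul (M := K ^ 2)
      ((hU n).continuous.measurable.pow_const 2) fun x => ?_
    rw [abs_pow]
    exact pow_le_pow_left₀ (abs_nonneg _) (hUb n x) 2
  simp_rw [Finset.mul_sum]
  rw [integral_finsetSum _ fun n _ => (key n).1, Finset.sum_congr rfl fun n _ => (key n).2.2,
    ← integral_finsetSum _ fun n _ => (key n).2.1, ← integral_const_mul]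
  simp_rw [← Finset.mul_sum]
  refine integral_mono (integrable_finsetSum _ fun n _ => (key n).2.1) (isq.const_mul C)
    fun x => ?_
  have hr := cauchyWeight_pos x
  calc ∑ n, (cauchyWeight x * (U n x * deriv (W n) x - deriv (U n) x * deriv (W n) x) -
        deriv cauchyWeight x * (U n x * deriv (W n) x))
      ≤ ∑ n, cauchyWeight x *
          (2 * (|U n x| * |deriv (W n) x|) - deriv (U n) x * deriv (W n) x) := by
        refine Finset.sum_le_sum fun n _ => ?_
        have h1 : U n x * deriv (W n) x ≤ |U n x| * |deriv (W n) x| := by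
          rw [← abs_mul]; exact le_abs_self _
        have h2 : -(deriv cauchyWeight x * (U n x * deriv (W n) x)) ≤
            cauchyWeight x * (|U n x| * |deriv (W n) x|) := by
          refine (neg_le_abs _).trans ?_
          rw [abs_mul, abs_mul]
          exact mul_le_mul_of_nonneg_right (abs_deriv_cauchyWeight_le x) (by positivity)
        have h3 := mul_le_mul_of_nonneg_left h1 hr.le
        linarith
    _ = cauchyWeight x *
          (2 * ∑ n, |U n x| * |deriv (W n) x| - ∑ n, deriv (U n) x * deriv (W n) x) := by
        rw [← Finset.mul_sum, Finset.sum_sub_distrib, Finset.mul_sum]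
    _ ≤ cauchyWeight x * (C * ∑ n, U n x ^ 2) := mul_le_mul_of_nonneg_left (hdiss x) hr.le
    _ = C * (cauchyWeight x * ∑ n, U n x ^ 2) := by ring

/-- Weighted energy uniqueness for systems `∂ₜ uₙ = ½ (∂ₓ² wₙ + ∂ₓ wₙ)` whose fluxes satisfy a
pointwise dissipation inequality. -/
lemma eq_zero_of_dissipative {ι : Type*} [Fintype ι] {T K C : ℝ} (hT : 0 < T)
    (u w : ι → ℝ → ℝ → ℝ)
    (hux : ∀ n, ∀ t ∈ Set.Icc 0 T, Differentiable ℝ (u n t))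
    (hut : ∀ n, ∀ t ∈ Set.Icc 0 T, ∀ x, DifferentiableAt ℝ (fun s => u n s x) t)
    (hw : ∀ n, ∀ t ∈ Set.Icc 0 T, ContDiff ℝ 2 (w n t))
    (hub : ∀ n, ∀ t ∈ Set.Icc 0 T, ∀ x, |u n t x| ≤ K ∧ |deriv (u n t) x| ≤ K ∧
      |deriv (fun s => u n s x) t| ≤ K ∧ |deriv (w n t) x| ≤ K)
    (hpde : ∀ n, ∀ t ∈ Set.Icc 0 T, ∀ x, deriv (fun s => u n s x) t =
      1 / 2 * deriv (deriv (w n t)) x + 1 / 2 * deriv (w n t) x)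
    (h0 : ∀ n x, u n 0 x = 0)
    (hdiss : ∀ t ∈ Set.Icc 0 T, ∀ x, 2 * ∑ n, |u n t x| * |deriv (w n t) x| -
      ∑ n, deriv (u n t) x * deriv (w n t) x ≤ C * ∑ n, u n t x ^ 2) :
    ∀ n, ∀ t ∈ Set.Icc 0 T, ∀ x, u n t x = 0 := by
  classical
  set E : ℝ → ℝ := fun t => ∫ x, cauchyWeight x * ∑ n, u n t x ^ 2 with hE
  set B : ℝ := Fintype.card ι * (2 * K * K) with hB
  have hmeas : ∀ t ∈ Set.Icc 0 T, Continuous fun x => ∑ n, u n t x ^ 2 := fun t ht =>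
    continuous_finsetSum _ fun n _ => (hux n t ht).continuous.pow 2
  have hcont : ∀ t ∈ Set.Icc 0 T, Continuous fun x => cauchyWeight x * ∑ n, u n t x ^ 2 :=
    fun t ht => continuous_cauchyWeight.mul (hmeas t ht)
  have hsq : ∀ t ∈ Set.Icc 0 T, ∀ x, |∑ n, u n t x ^ 2| ≤ B := fun t ht x => by
    refine (Finset.abs_sum_le_sum_abs _ _).trans ?_
    rw [hB, ← nsmul_eq_mul]
    refine Finset.sum_le_card_nsmul _ _ _ fun n _ => ?_
    have h := (hub n t ht x).1
    rw [abs_pow]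
    nlinarith [abs_nonneg (u n t x)]
  have hbound : Integrable fun x => cauchyWeight x * B :=
    integrable_cauchyWeight_mul (g := fun _ => B) measurable_const fun _ => le_rfl
  have hint : ∀ t ∈ Set.Icc 0 T, Integrable fun x => cauchyWeight x * ∑ n, u n t x ^ 2 :=
    fun t ht => integrable_cauchyWeight_mul (hmeas t ht).measurable (hsq t ht)
  have hEcont : ContinuousOn E (Set.Icc 0 T) := by
    refine continuousOn_of_dominated (bound := fun x => cauchyWeight x * B)
      (fun t ht => (hcont t ht).aestronglyMeasurable) (fun t ht => ae_of_all _ fun x => ?_) hbound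
      (ae_of_all _ fun x => ?_)
    · rw [Real.norm_eq_abs, abs_mul, abs_of_pos (cauchyWeight_pos x)]
      exact mul_le_mul_of_nonneg_left (hsq t ht x) (cauchyWeight_pos x).le
    · exact continuousOn_const.mul (continuousOn_finsetSum _ fun n _ =>
        ContinuousOn.pow (fun t ht => (hut n t ht x).continuousAt.continuousWithinAt) 2)
  have hEderiv : ∀ t ∈ Set.Ioo 0 T, HasDerivAt E
      (∫ x, cauchyWeight x * ∑ n, 2 * u n t x * deriv (fun s => u n s x) t) t := by
    intro t ht
    have hsub : ∀ s ∈ Set.Ioo 0 T, s ∈ Set.Icc 0 T := fun s hs => Set.Ioo_subset_Icc_self hs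
    refine (hasDerivAt_integral_of_dominated_loc_of_deriv_le (s := Set.Ioo 0 T)
      (F := fun t x => cauchyWeight x * ∑ n, u n t x ^ 2)
      (F' := fun t x => cauchyWeight x * ∑ n, 2 * u n t x * deriv (fun s => u n s x) t)
      (bound := fun x => cauchyWeight x * B) (isOpen_Ioo.mem_nhds ht) ?_ (hint t (hsub t ht)) ?_
      (ae_of_all _ fun x s hs => ?_) hbound (ae_of_all _ fun x s hs => ?_)).2
    · filter_upwards [isOpen_Ioo.mem_nhds ht] with s hs
      exact (hcont s (hsub s hs)).aestronglyMeasurable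
    · refine (continuous_cauchyWeight.measurable.mul
        (Finset.measurable_fun_sum _ fun n _ => ?_)).aestronglyMeasurable
      simp_rw [hpde n t (hsub t ht)]
      exact ((hux n t (hsub t ht)).continuous.measurable.const_mul 2).mul
        (((measurable_deriv _).const_mul _).add ((measurable_deriv _).const_mul _))
    · rw [Real.norm_eq_abs, abs_mul, abs_of_pos (cauchyWeight_pos x)]
      refine mul_le_mul_of_nonneg_left ((Finset.abs_sum_le_sum_abs _ _).trans ?_)
        (cauchyWeight_pos x).le
      rw [hB, ← nsmul_eq_mul]
      refine Finset.sum_le_card_nsmul _ _ _ fun n _ => ?_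
      obtain ⟨h1, -, h2, -⟩ := hub n s (hsub s hs) x
      rw [abs_mul, abs_mul, abs_two]
      have hK : 0 ≤ K := (abs_nonneg _).trans h1
      gcongr
    · refine HasDerivAt.const_mul _ (HasDerivAt.fun_sum fun n _ => ?_)
      simpa using (hut n s (hsub s hs) x).hasDerivAt.fun_pow 2
  have hanti : AntitoneOn (fun t => Real.exp (-C * t) * E t) (Set.Icc 0 T) := by
    have hd : ∀ t ∈ interior (Set.Icc 0 T), HasDerivAt (fun t => Real.exp (-C * t) * E t)
        (Real.exp (-C * t) * (-C) * E t + Real.exp (-C * t) *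
          ∫ x, cauchyWeight x * ∑ n, 2 * u n t x * deriv (fun s => u n s x) t) t := by
      intro t ht
      rw [interior_Icc] at ht
      refine HasDerivAt.mul ?_ (hEderiv t ht)
      simpa using ((hasDerivAt_id t).const_mul (-C)).exp
    refine antitoneOn_of_deriv_nonpos (convex_Icc 0 T) (by fun_prop)
      (fun t ht => (hd t ht).differentiableAt.differentiableWithinAt) fun t ht => ?_
    rw [(hd t ht).deriv]
    have ht' := interior_subset ht
    have h := integral_cauchyWeight_energy_le (U := fun n => u n t) (W := fun n => w n t)
      (V := fun n x => deriv (fun s => u n s x) t) (fun n => hux n t ht') (fun n => hw n t ht')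
      (fun n x => (hub n t ht' x).1) (fun n x => (hub n t ht' x).2.1)
      (fun n x => (hub n t ht' x).2.2.1) (fun n x => (hub n t ht' x).2.2.2)
      (fun n x => hpde n t ht' x) (hdiss t ht')
    have := mul_le_mul_of_nonneg_left h (Real.exp_pos (-C * t)).le
    simp only [hE]
    linarith
  intro n t ht x
  have hE0 : E 0 = 0 := by simp [hE, h0]
  have hle : E t ≤ 0 := by
    have := hanti ⟨le_rfl, hT.le⟩ ht ht.1
    simp only [hE0, mul_zero] at this
    exact nonpos_of_mul_nonpos_right this (Real.exp_pos _)
  have hnn : ∀ y, 0 ≤ cauchyWeight y * ∑ n, u n t y ^ 2 := fun y =>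
    mul_nonneg (cauchyWeight_pos y).le (Finset.sum_nonneg fun _ _ => sq_nonneg _)
  have hEt : E t = 0 := le_antisymm hle (integral_nonneg hnn)
  have hae := (integral_eq_zero_iff_of_nonneg hnn (hint t ht)).1 hEt
  have hx := congrFun ((hcont t ht).ae_eq_iff_eq volume continuous_const |>.1 hae) x
  have hs := (mul_eq_zero.1 hx).resolve_left (cauchyWeight_pos x).ne'
  exact pow_eq_zero_iff two_ne_zero |>.1
    ((Finset.sum_eq_zero_iff_of_nonneg fun _ _ => sq_nonneg _).1 hs n (Finset.mem_univ n))

/-- A flux derivative that is coercive up to lower order terms satisfies the dissipation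
inequality. -/
lemma dissipation_of_coercive {ι : Type*} [Fintype ι] {c C : ℝ} (hc : 0 < c) (hC : 0 ≤ C)
    {u v w L : ι → ℝ} (hwL : ∀ n, |w n - L n| ≤ C * ∑ k, |u k|) (hL : ∀ n, |L n| ≤ C * ∑ k, |v k|)
    (hcoer : c * ∑ n, v n ^ 2 ≤ ∑ n, v n * L n) :
    2 * ∑ n, |u n| * |w n| - ∑ n, v n * w n ≤
      (2 * C + 9 * C ^ 2 * (Fintype.card ι + 1) / (4 * c)) * Fintype.card ι * ∑ n, u n ^ 2 := by
  set U := ∑ k, |u k| with hU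
  set V := ∑ k, |v k| with hV
  set N : ℝ := ((Fintype.card ι : ℕ) : ℝ) with hN
  have hN0 : 0 ≤ N := Nat.cast_nonneg _
  have hU0 : 0 ≤ U := Finset.sum_nonneg fun _ _ => abs_nonneg _
  have hV0 : 0 ≤ V := Finset.sum_nonneg fun _ _ => abs_nonneg _
  have hUsq : U ^ 2 ≤ N * ∑ n, u n ^ 2 := by
    simpa [hN] using sq_sum_le_card_mul_sum_sq (s := Finset.univ) (f := fun k => |u k|)
  have hVsq : V ^ 2 ≤ N * ∑ n, v n ^ 2 := by
    simpa [hN] using sq_sum_le_card_mul_sum_sq (s := Finset.univ) (f := fun k => |v k|)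
  have hv0 : 0 ≤ ∑ n, v n ^ 2 := Finset.sum_nonneg fun _ _ => sq_nonneg _
  have h1 : ∑ n, |u n| * |w n| ≤ U * (C * U + C * V) := by
    rw [hU, Finset.sum_mul]
    refine Finset.sum_le_sum fun n _ => mul_le_mul_of_nonneg_left ?_ (abs_nonneg _)
    calc |w n| = |(w n - L n) + L n| := by ring_nf
      _ ≤ _ := (abs_add_le _ _).trans (add_le_add (hwL n) (hL n))
  have h2 : -∑ n, v n * w n ≤ V * (C * U) - c * ∑ n, v n ^ 2 := by
    have h3 : -∑ n, v n * (w n - L n) ≤ V * (C * U) := by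
      rw [← Finset.sum_neg_distrib, hV, Finset.sum_mul]
      refine Finset.sum_le_sum fun n _ => (neg_le_abs _).trans ?_
      rw [abs_mul]
      exact mul_le_mul_of_nonneg_left (hwL n) (abs_nonneg _)
    simp only [mul_sub, Finset.sum_sub_distrib] at h3
    linarith
  have h4 : 3 * C * U * V ≤ 9 * C ^ 2 * (N + 1) / (4 * c) * U ^ 2 + c / (N + 1) * V ^ 2 := by
    have : 9 * C ^ 2 * (N + 1) / (4 * c) * U ^ 2 + c / (N + 1) * V ^ 2 - 3 * C * U * V =
        (3 * C * (N + 1) * U - 2 * c * V) ^ 2 / (4 * c * (N + 1)) := by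
      field_simp; ring
    have h5 : 0 ≤ (3 * C * (N + 1) * U - 2 * c * V) ^ 2 / (4 * c * (N + 1)) := by positivity
    linarith
  have h6 : c / (N + 1) * V ^ 2 ≤ c * ∑ n, v n ^ 2 := by
    rw [div_mul_eq_mul_div, div_le_iff₀ (by positivity)]
    nlinarith
  have h7 := mul_le_mul_of_nonneg_left hUsq
    (show 0 ≤ 2 * C + 9 * C ^ 2 * (N + 1) / (4 * c) by positivity)
  nlinarith

/-- Uniqueness for systems `∂ₜ uₙ = ½ (∂ₓ² wₙ + ∂ₓ wₙ)` whose fluxes are coercive up to lower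
order terms. -/
lemma eq_zero_of_coercive {ι : Type*} [Fintype ι] {T K c C : ℝ} (hT : 0 < T) (hc : 0 < c)
    (hC : 0 ≤ C) (u w L : ι → ℝ → ℝ → ℝ)
    (hux : ∀ n, ∀ t ∈ Set.Icc 0 T, Differentiable ℝ (u n t))
    (hut : ∀ n, ∀ t ∈ Set.Icc 0 T, ∀ x, DifferentiableAt ℝ (fun s => u n s x) t)
    (hw : ∀ n, ∀ t ∈ Set.Icc 0 T, ContDiff ℝ 2 (w n t))
    (hub : ∀ n, ∀ t ∈ Set.Icc 0 T, ∀ x, |u n t x| ≤ K ∧ |deriv (u n t) x| ≤ K ∧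
      |deriv (fun s => u n s x) t| ≤ K)
    (hpde : ∀ n, ∀ t ∈ Set.Icc 0 T, ∀ x, deriv (fun s => u n s x) t =
      1 / 2 * deriv (deriv (w n t)) x + 1 / 2 * deriv (w n t) x)
    (h0 : ∀ n x, u n 0 x = 0)
    (hwL : ∀ n, ∀ t ∈ Set.Icc 0 T, ∀ x, |deriv (w n t) x - L n t x| ≤ C * ∑ k, |u k t x|)
    (hL : ∀ n, ∀ t ∈ Set.Icc 0 T, ∀ x, |L n t x| ≤ C * ∑ k, |deriv (u k t) x|)
    (hcoer : ∀ t ∈ Set.Icc 0 T, ∀ x, c * ∑ n, deriv (u n t) x ^ 2 ≤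
      ∑ n, deriv (u n t) x * L n t x) :
    ∀ n, ∀ t ∈ Set.Icc 0 T, ∀ x, u n t x = 0 := by
  have hw' : ∀ n, ∀ t ∈ Set.Icc 0 T, ∀ x,
      |deriv (w n t) x| ≤ 2 * (C * (Fintype.card ι * K)) := by
    intro n t ht x
    have h1 : ∑ k, |u k t x| ≤ Fintype.card ι * K := by
      rw [← nsmul_eq_mul]
      exact Finset.sum_le_card_nsmul _ _ _ fun k _ => (hub k t ht x).1
    have h2 : ∑ k, |deriv (u k t) x| ≤ Fintype.card ι * K := by
      rw [← nsmul_eq_mul]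
      exact Finset.sum_le_card_nsmul _ _ _ fun k _ => (hub k t ht x).2.1
    have h3 := (hwL n t ht x).trans (mul_le_mul_of_nonneg_left h1 hC)
    have h4 := (hL n t ht x).trans (mul_le_mul_of_nonneg_left h2 hC)
    calc |deriv (w n t) x| = |(deriv (w n t) x - L n t x) + L n t x| := by ring_nf
      _ ≤ _ := (abs_add_le _ _).trans (add_le_add h3 h4)
      _ = _ := by ring
  refine eq_zero_of_dissipative (K := max K (2 * (C * (Fintype.card ι * K)))) hT u w hux hut hw
    (fun n t ht x => ?_) hpde h0
    fun t ht x => dissipation_of_coercive hc hC (fun n => hwL n t ht x) (fun n => hL n t ht x)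
      (hcoer t ht x)
  obtain ⟨h1, h2, h3⟩ := hub n t ht x
  exact ⟨h1.trans (le_max_left _ _), h2.trans (le_max_left _ _), h3.trans (le_max_left _ _),
    (hw' n t ht x).trans (le_max_right _ _)⟩

/-- Nonnegativity of the quadratic form `Σ f ξ² + (Σ ξ)(Σ f ξ)`. -/
lemma sum_mul_sq_add_sum_mul_sum_nonneg {ι : Type*} (s : Finset ι) (hs : s.Nonempty) {f : ι → ℝ}
    (hf : ∀ n, 0 < f n)
    (hsqrt : Real.sqrt ((∑ n ∈ s, f n) * ∑ n ∈ s, (f n)⁻¹) ≤ s.card + 2) (ξ : ι → ℝ) :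
    0 ≤ ∑ n ∈ s, f n * ξ n ^ 2 + (∑ n ∈ s, ξ n) * ∑ n ∈ s, f n * ξ n := by
  set A := ∑ n ∈ s, f n with hA
  set B := ∑ n ∈ s, (f n)⁻¹ with hB
  set G := ∑ n ∈ s, f n * ξ n ^ 2 with hG
  set Y := ∑ n ∈ s, ξ n with hY
  set Z := ∑ n ∈ s, f n * ξ n with hZ
  have hA0 : 0 < A := Finset.sum_pos (fun n _ => hf n) hs
  have hB0 : 0 < B := Finset.sum_pos (fun n _ => inv_pos.2 (hf n)) hs
  have hG0 : 0 ≤ G := Finset.sum_nonneg fun n _ => mul_nonneg (hf n).le (sq_nonneg _)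
  obtain ⟨μ, hμ, hμA, hμB⟩ : ∃ μ : ℝ, 0 < μ ∧ μ ^ 2 * B = A ∧ μ * B = Real.sqrt (A * B) := by
    refine ⟨Real.sqrt (A * B) / B, by positivity, ?_, by field_simp⟩
    rw [div_pow, Real.sq_sqrt (by positivity)]
    field_simp
  have hCS : (∑ n ∈ s, (f n - μ) * ξ n) ^ 2 ≤
      (∑ n ∈ s, (f n - μ) ^ 2 * (f n)⁻¹) * ∑ n ∈ s, f n * ξ n ^ 2 :=
    Finset.sum_sq_le_sum_mul_sum_of_sq_le_mul s
      (fun n _ => mul_nonneg (sq_nonneg _) (inv_pos.2 (hf n)).le)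
      (fun n _ => mul_nonneg (hf n).le (sq_nonneg _)) fun n _ => le_of_eq (by
        have := (hf n).ne'
        field_simp)
  have e1 : ∑ n ∈ s, (f n - μ) * ξ n = Z - μ * Y := by
    simp [hZ, hY, sub_mul, Finset.mul_sum]
  have e2 : ∑ n ∈ s, (f n - μ) ^ 2 * (f n)⁻¹ = A - 2 * μ * s.card + μ ^ 2 * B := by
    have : ∀ n ∈ s, (f n - μ) ^ 2 * (f n)⁻¹ = f n - 2 * μ + μ ^ 2 * (f n)⁻¹ := fun n _ => by
      have := (hf n).ne'
      field_simp
      ring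
    rw [Finset.sum_congr rfl this, Finset.sum_add_distrib, Finset.sum_sub_distrib]
    simp [hA, hB, Finset.mul_sum]
    ring
  rw [e1, e2] at hCS
  have h1 : A - 2 * μ * s.card + μ ^ 2 * B ≤ 4 * μ := by
    have : μ * (μ * B) ≤ μ * (s.card + 2) := mul_le_mul_of_nonneg_left (hμB ▸ hsqrt) hμ.le
    nlinarith
  have h2 := mul_le_mul_of_nonneg_right h1 hG0
  have h3 : 0 ≤ 4 * μ * (G + Y * Z) := by nlinarith [sq_nonneg (Z + μ * Y)]
  exact nonneg_of_mul_nonneg_right h3 (by positivity)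

lemma sum_mul_sq_sub_mul_sum_nonneg {N : ℕ} (hN : 2 ≤ N) {f : Fin N → ℝ} (hf : ∀ n, 0 < f n)
    (hsqrt : ∀ k, Real.sqrt ((∑ n ∈ univ.erase k, f n) * ∑ n ∈ univ.erase k, (f n)⁻¹) ≤ N + 1)
    {ξ : Fin N → ℝ} (hξ : ∑ n, ξ n = 0) (j : Fin N) :
    0 ≤ ∑ n, f n * ξ n ^ 2 - ξ j * ∑ n, f n * ξ n := by
  have hcard : (univ.erase j).card = N - 1 := by simp
  have hs : (univ.erase j).Nonempty := by rw [← Finset.card_pos, hcard]; omega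
  have h := sum_mul_sq_add_sum_mul_sum_nonneg (univ.erase j) hs hf (by
    rw [hcard, Nat.cast_sub (by omega)]
    have := hsqrt j
    push_cast
    linarith) ξ
  rw [← Finset.add_sum_erase _ _ (Finset.mem_univ j)] at hξ
  rw [← Finset.add_sum_erase _ (fun n => f n * ξ n ^ 2) (Finset.mem_univ j),
    ← Finset.add_sum_erase _ (fun n => f n * ξ n) (Finset.mem_univ j)]
  have e : ∑ n ∈ univ.erase j, ξ n = -ξ j := by linarith
  rw [e] at h
  nlinarith

lemma mul_sum_sq_sub_mul_sum_nonneg {N : ℕ} {f : Fin N → ℝ} (hf : ∀ n, 0 < f n) {a : ℝ}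
    (hdev : ∀ k, Real.sqrt (∑ n, (f n - a) ^ 2) ≤ f k)
    {ξ : Fin N → ℝ} (hξ : ∑ n, ξ n = 0) (j : Fin N) :
    0 ≤ f j * ∑ n, ξ n ^ 2 - ξ j * ∑ n, f n * ξ n := by
  have e : ∑ n, f n * ξ n = ∑ n, (f n - a) * ξ n := by
    simp [sub_mul, ← Finset.mul_sum, hξ]
  have hX : 0 ≤ ∑ n, ξ n ^ 2 := Finset.sum_nonneg fun _ _ => sq_nonneg _
  have h1 : (∑ n, f n * ξ n) ^ 2 ≤ f j ^ 2 * ∑ n, ξ n ^ 2 := by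
    rw [e]
    refine (Finset.sum_mul_sq_le_sq_mul_sq _ _ _).trans (mul_le_mul_of_nonneg_right ?_ hX)
    exact (Real.sqrt_le_left (hf j).le).1 (hdev j)
  have h2 : ξ j ^ 2 ≤ ∑ n, ξ n ^ 2 :=
    Finset.single_le_sum (f := fun n => ξ n ^ 2) (fun _ _ => sq_nonneg _) (Finset.mem_univ j)
  have h3 : |ξ j * ∑ n, f n * ξ n| ≤ f j * ∑ n, ξ n ^ 2 := by
    refine abs_le_of_sq_le_sq ?_ (mul_nonneg (hf j).le hX)
    calc (ξ j * ∑ n, f n * ξ n) ^ 2 = ξ j ^ 2 * (∑ n, f n * ξ n) ^ 2 := by ring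
      _ ≤ (∑ n, ξ n ^ 2) * (f j ^ 2 * ∑ n, ξ n ^ 2) :=
        mul_le_mul h2 h1 (sq_nonneg _) hX
      _ = _ := by ring
  linarith [le_abs_self (ξ j * ∑ n, f n * ξ n)]

/-- Coercivity, on vectors of zero sum, of the Jacobian of `r ↦ (rₙ (ε + fₙ Σ r) / (ε + Σ f r))ₙ`
(multiplied by the squared denominator). -/
lemma jacobian_coercive {N : ℕ} (hN : 2 ≤ N) {f : Fin N → ℝ} (hf : ∀ n, 0 < f n) {a ε : ℝ}
    (hε : 0 ≤ ε)
    (hsqrt : ∀ k, Real.sqrt ((∑ n ∈ univ.erase k, f n) * ∑ n ∈ univ.erase k, (f n)⁻¹) ≤ N + 1)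
    (hdev : ∀ k, Real.sqrt (∑ n, (f n - a) ^ 2) ≤ f k)
    {r ξ : Fin N → ℝ} (hr : ∀ n, 0 ≤ r n) (hξ : ∑ n, ξ n = 0) :
    ε ^ 2 * ∑ n, ξ n ^ 2 ≤
      ∑ n, ξ n * ((ε + f n * ∑ k, r k) * ((ε + ∑ k, f k * r k) * ξ n - r n * ∑ k, f k * ξ k)) := by
  have h1 := sum_mul_sq_sub_mul_sum_nonneg hN hf hsqrt hξ
  have h2 := mul_sum_sq_sub_mul_sum_nonneg hf hdev hξ
  set Z := ∑ k, f k * ξ k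
  set S := ∑ k, r k with hS
  set G := ∑ n, f n * ξ n ^ 2 with hG
  set X := ∑ n, ξ n ^ 2 with hX
  set F := ∑ k, f k * r k with hF
  have hS0 : 0 ≤ S := Finset.sum_nonneg fun n _ => hr n
  have hG0 : 0 ≤ G := Finset.sum_nonneg fun n _ => mul_nonneg (hf n).le (sq_nonneg _)
  have h3 : 0 ≤ ∑ j, r j * (f j * S * (G - ξ j * Z) + ε * (f j * X - ξ j * Z)) :=
    Finset.sum_nonneg fun j _ => mul_nonneg (hr j) (add_nonneg
      (mul_nonneg (mul_nonneg (hf j).le hS0) (h1 j)) (mul_nonneg hε (h2 j)))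
  have e1 : ∑ j, r j * (f j * S * (G - ξ j * Z) + ε * (f j * X - ξ j * Z)) =
      F * (S * G + ε * X) - ∑ j, r j * (f j * S + ε) * ξ j * Z := by
    rw [hF, Finset.sum_mul, ← Finset.sum_sub_distrib]
    exact Finset.sum_congr rfl fun j _ => by ring
  have e2 : ∑ n, ξ n * ((ε + f n * S) * ((ε + F) * ξ n - r n * Z)) =
      (ε + F) * (ε * X + S * G) - ∑ j, r j * (f j * S + ε) * ξ j * Z := by
    rw [hX, hG, Finset.mul_sum, Finset.mul_sum, ← Finset.sum_add_distrib, Finset.mul_sum,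
      ← Finset.sum_sub_distrib]
    exact Finset.sum_congr rfl fun j _ => by ring
  rw [e2]
  have h4 : 0 ≤ ε * S * G := by positivity
  nlinarith

/-- The consequences of Condition (C) used for coercivity. -/
lemma condition_consequences {N : ℕ} (hN : 2 ≤ N) {f : Fin N → ℝ} (hf : ∀ n, 0 < f n)
    (hC : min (kappa0 N f) 1 > betaf N f) :
    (∀ k, Real.sqrt ((∑ n ∈ univ.erase k, f n) * ∑ n ∈ univ.erase k, (f n)⁻¹) ≤ N + 1) ∧
    ∀ k, Real.sqrt (∑ n, (f n - fbar N f) ^ 2) ≤ f k := by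
  have : Nonempty (Fin N) := ⟨⟨0, by omega⟩⟩
  have hmin : ∀ k, fmin N f ≤ f k := fun k => ciInf_le (Set.finite_range f).bddBelow k
  have hmax : ∀ k, f k ≤ fmax N f := fun k => le_ciSup (Set.finite_range f).bddAbove k
  obtain ⟨j, hj⟩ := exists_eq_ciInf_of_finite (f := f)
  have hpos : 0 < fmin N f := by rw [fmin, ← hj]; exact hf j
  have h1 : 0 ≤ (fmax N f - fmin N f) / fmin N f :=
    div_nonneg (sub_nonneg.2 ((hmin j).trans (hmax j))) hpos.le
  have h2 : 0 ≤ 1 / fmin N f * Real.sqrt (∑ n, (f n - fbar N f) ^ 2) := by positivity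
  have hb : betaf N f = (fmax N f - fmin N f) / fmin N f +
    (1 / fmin N f) * Real.sqrt (∑ n, (f n - fbar N f) ^ 2) := rfl
  have hk := lt_min_iff.1 hC
  refine ⟨fun k => ?_, fun k => ?_⟩
  · have h3 : 0 < kappa0 N f := by linarith [hk.1]
    have h4 := le_ciSup (f := fun k : Fin N =>
      Real.sqrt ((∑ n ∈ univ.erase k, f n) * ∑ n ∈ univ.erase k, (f n)⁻¹))
      (Set.finite_range _).bddAbove k
    unfold kappa0 at h3
    linarith
  · refine le_trans ?_ (hmin k)
    have h3 : 1 / fmin N f * Real.sqrt (∑ n, (f n - fbar N f) ^ 2) ≤ 1 := by linarith [hk.2]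
    rwa [one_div_mul_eq_div, div_le_one hpos] at h3

lemma MemParabHolder.contDiff_two {γ T : ℝ} {φ : ℝ → ℝ → ℝ} (hγ : 0 < γ)
    (hφ : MemParabHolder γ T φ) {t : ℝ} (ht : t ∈ Set.Icc 0 T) : ContDiff ℝ 2 (φ t) := by
  obtain ⟨hd, K, -, -, hx⟩ := hφ
  have h : ContDiff ℝ (1 + 1) (φ t) := by
    refine contDiff_succ_iff_deriv.2 ⟨fun x => (hd t ht x).1, by simp, ?_⟩
    refine contDiff_one_iff_deriv.2 ⟨fun x => (hd t ht x).2.1, ?_⟩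
    refine continuous_iff_continuousAt.2 fun x => tendsto_iff_dist_tendsto_zero.2 ?_
    refine squeeze_zero (fun _ => dist_nonneg) (fun y => (hx t ht y x).1) ?_
    have hc : Continuous fun y : ℝ => K * |y - x| ^ γ :=
      continuous_const.mul ((continuous_id.sub continuous_const).abs.rpow_const
        fun _ => Or.inr hγ.le)
    simpa [Real.zero_rpow hγ.ne'] using hc.tendsto x
  rw [one_add_one_eq_two] at h
  exact h

lemma MemParabHolder.exists_bound {ι : Type*} [Fintype ι] {γ T : ℝ} {φ : ι → ℝ → ℝ → ℝ}
    (hφ : ∀ n, MemParabHolder γ T (φ n)) :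
    ∃ K : ℝ, 0 ≤ K ∧ ∀ n, ∀ t ∈ Set.Icc (0 : ℝ) T, ∀ x : ℝ,
      |φ n t x| ≤ K ∧ |deriv (φ n t) x| ≤ K ∧ |deriv (fun s => φ n s x) t| ≤ K := by
  choose _ K hK _ _ using hφ
  refine ⟨∑ n, |K n|, Finset.sum_nonneg fun _ _ => abs_nonneg _, fun n t ht x => ?_⟩
  have h : K n ≤ ∑ n, |K n| := (le_abs_self _).trans
    (Finset.single_le_sum (f := fun n => |K n|) (fun _ _ => abs_nonneg _) (Finset.mem_univ n))
  obtain ⟨h1, h2, -, h3⟩ := hK n t ht x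
  exact ⟨h1.trans h, h2.trans h, h3.trans h⟩

lemma abs_mul_le_of_abs_le {a b A B : ℝ} (ha : |a| ≤ A) (hb : |b| ≤ B) : |a * b| ≤ A * B := by
  rw [abs_mul]
  exact mul_le_mul ha hb (abs_nonneg _) ((abs_nonneg _).trans ha)

lemma abs_sum_mul_le {ι : Type*} [Fintype ι] {a b : ι → ℝ} {A : ℝ} (ha : ∀ n, |a n| ≤ A) :
    |∑ n, a n * b n| ≤ A * ∑ n, |b n| := by
  rw [Finset.mul_sum]
  refine (Finset.abs_sum_le_sum_abs _ _).trans (Finset.sum_le_sum fun n _ => ?_)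
  rw [abs_mul]
  exact mul_le_mul_of_nonneg_right (ha n) (abs_nonneg _)

/-- The lower order part of the difference of two flux derivatives, estimated pointwise. -/
lemma abs_flux_remainder_le {p q q' s s' g g' i j Fq' Z K V : ℝ}
    (hq : |q| ≤ K) (hq' : |q'| ≤ K) (hs : |s| ≤ K) (hs' : |s'| ≤ K) (hg : |g| ≤ K)
    (hg' : |g'| ≤ K) (hi : |i| ≤ K) (hj : |j| ≤ K) (hFq' : |Fq'| ≤ K) (hij : i - j = -(Z * (i * j)))
    (hZ : |Z| ≤ K * V) (hu : |p - q| ≤ V) :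
    |(2 * s * s' * g + s ^ 2 * g') * (p * i - q * j) +
      s ^ 2 * g * (q' * (i - j) - Fq' * (p * i ^ 2 - q * j ^ 2))| ≤
      (3 * K ^ 3 * (K + K ^ 4) + K ^ 3 * (K ^ 4 + K ^ 3 + 2 * K ^ 6)) * V := by
  have h1 : |i - j| ≤ K * V * (K * K) := by
    rw [hij, abs_neg]
    exact abs_mul_le_of_abs_le hZ (abs_mul_le_of_abs_le hi hj)
  have h2 : |p * i - q * j| ≤ V * K + K * (K * V * (K * K)) := by
    have : p * i - q * j = (p - q) * i + q * (i - j) := by ring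
    rw [this]
    exact (abs_add_le _ _).trans
      (add_le_add (abs_mul_le_of_abs_le hu hi) (abs_mul_le_of_abs_le hq h1))
  have h3 : |p * i ^ 2 - q * j ^ 2| ≤
      (V * K + K * (K * V * (K * K))) * K + K * K * (K * V * (K * K)) := by
    have : p * i ^ 2 - q * j ^ 2 = (p * i - q * j) * i + q * j * (i - j) := by ring
    rw [this]
    exact (abs_add_le _ _).trans (add_le_add (abs_mul_le_of_abs_le h2 hi)
      (abs_mul_le_of_abs_le (abs_mul_le_of_abs_le hq hj) h1))
  have h4 : |2 * s * s' * g + s ^ 2 * g'| ≤ 2 * K * K * K + K * K * K := by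
    rw [pow_two]
    exact (abs_add_le _ _).trans (add_le_add
      (abs_mul_le_of_abs_le (abs_mul_le_of_abs_le (abs_mul_le_of_abs_le abs_two.le hs) hs') hg)
      (abs_mul_le_of_abs_le (abs_mul_le_of_abs_le hs hs) hg'))
  have h5 : |s ^ 2 * g| ≤ K * K * K := by
    rw [pow_two]
    exact abs_mul_le_of_abs_le (abs_mul_le_of_abs_le hs hs) hg
  have h6 := (abs_sub _ _).trans
    (add_le_add (abs_mul_le_of_abs_le hq' h1) (abs_mul_le_of_abs_le hFq' h3))
  refine (abs_add_le _ _).trans ((add_le_add (abs_mul_le_of_abs_le h4 h2)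
    (abs_mul_le_of_abs_le h5 h6)).trans (le_of_eq ?_))
  ring

/-- The principal part of the difference of two flux derivatives, estimated pointwise. -/
lemma abs_flux_principal_le {p v s g i Z K V : ℝ}
    (hp : |p| ≤ K) (hs : |s| ≤ K) (hg : |g| ≤ K) (hi : |i| ≤ K) (hZ : |Z| ≤ K * V)
    (hv : |v| ≤ V) :
    |s ^ 2 * g * (v * i - p * Z * i ^ 2)| ≤ K ^ 3 * (K + K ^ 4) * V := by
  rw [pow_two, pow_two]
  refine (abs_mul_le_of_abs_le (abs_mul_le_of_abs_le (abs_mul_le_of_abs_le hs hs) hg)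
    ((abs_sub _ _).trans (add_le_add (abs_mul_le_of_abs_le hv hi)
      (abs_mul_le_of_abs_le (abs_mul_le_of_abs_le hp hZ) (abs_mul_le_of_abs_le hi hi))))).trans
    (le_of_eq ?_)
  ring

/-- The flux `σ² Bₙ(p) pₙ`. -/
noncomputable def spdeFlux (N : ℕ) (f : Fin N → ℝ) (ε : ℝ) (σ : ℝ → ℝ → ℝ)
    (p : Fin N → ℝ → ℝ → ℝ) (n : Fin N) (t x : ℝ) : ℝ :=
  σ t x ^ 2 * Bfun N f ε p n t x * p n t x

section Flux

variable {N : ℕ} {f : Fin N → ℝ} {ε : ℝ} {σ : ℝ → ℝ → ℝ} {p q : Fin N → ℝ → ℝ → ℝ} {t : ℝ}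

lemma le_Bfun_denom (hf : ∀ n, 0 < f n) (hp : ∀ n x, 0 ≤ p n t x) (x : ℝ) :
    ε ≤ ε + ∑ k, f k * p k t x :=
  le_add_of_nonneg_right (Finset.sum_nonneg fun n _ => mul_nonneg (hf n).le (hp n x))

lemma contDiff_spdeFlux (hf : ∀ n, 0 < f n) (hε : 0 < ε) (hσ : ContDiff ℝ 2 (σ t))
    (hp : ∀ n x, 0 ≤ p n t x) (hpd : ∀ n, ContDiff ℝ 2 (p n t)) (n : Fin N) :
    ContDiff ℝ 2 (spdeFlux N f ε σ p n t) := by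
  have hS : ContDiff ℝ 2 fun x => ε + f n * ∑ k, p k t x :=
    contDiff_const.add (contDiff_const.mul (ContDiff.sum fun k _ => hpd k))
  have hF : ContDiff ℝ 2 fun x => ε + ∑ k, f k * p k t x :=
    contDiff_const.add (ContDiff.sum fun k _ => contDiff_const.mul (hpd k))
  exact ((hσ.pow 2).mul (hS.div hF fun x => (hε.trans_le (le_Bfun_denom hf hp x)).ne')).mul (hpd n)

lemma sum_spdeFlux (hf : ∀ n, 0 < f n) (hε : 0 < ε) (hp : ∀ n x, 0 ≤ p n t x) (x : ℝ) :
    ∑ n, spdeFlux N f ε σ p n t x = σ t x ^ 2 * ∑ n, p n t x := by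
  have hD := (hε.trans_le (le_Bfun_denom hf hp x)).ne'
  have h : ∀ n, spdeFlux N f ε σ p n t x = σ t x ^ 2 / (ε + ∑ k, f k * p k t x) *
      (ε * p n t x + (∑ k, p k t x) * (f n * p n t x)) := fun n => by
    unfold spdeFlux Bfun
    field_simp
  rw [Finset.sum_congr rfl fun n _ => h n, ← Finset.mul_sum, Finset.sum_add_distrib,
    ← Finset.mul_sum, ← Finset.mul_sum]
  field_simp

lemma deriv_spdeFlux (hf : ∀ n, 0 < f n) (hε : 0 < ε) (hσ : Differentiable ℝ (σ t))
    (hp : ∀ n x, 0 ≤ p n t x) (hpd : ∀ n, Differentiable ℝ (p n t)) (n : Fin N) (x : ℝ) :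
    deriv (spdeFlux N f ε σ p n t) x =
      (2 * σ t x * deriv (σ t) x * (ε + f n * ∑ k, p k t x) +
        σ t x ^ 2 * (f n * ∑ k, deriv (p k t) x)) * (p n t x * (ε + ∑ k, f k * p k t x)⁻¹) +
      σ t x ^ 2 * (ε + f n * ∑ k, p k t x) *
        (deriv (p n t) x * (ε + ∑ k, f k * p k t x)⁻¹ -
          p n t x * (∑ k, f k * deriv (p k t) x) * (ε + ∑ k, f k * p k t x)⁻¹ ^ 2) := by
  have hD := (hε.trans_le (le_Bfun_denom hf hp x)).ne'
  have hS : HasDerivAt (fun x => ε + f n * ∑ k, p k t x) (f n * ∑ k, deriv (p k t) x) x :=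
    ((HasDerivAt.fun_sum fun k _ => (hpd k x).hasDerivAt).const_mul _).const_add _
  have hF : HasDerivAt (fun x => ε + ∑ k, f k * p k t x) (∑ k, f k * deriv (p k t) x) x :=
    (HasDerivAt.fun_sum fun k _ => (hpd k x).hasDerivAt.const_mul _).const_add _
  have h := (((hσ x).hasDerivAt.pow 2).mul (hS.div hF hD)).mul (hpd n x).hasDerivAt
  refine (HasDerivAt.deriv h).trans ?_
  simp
  field_simp
  ring

end Flux

lemma deriv_deriv_sub_of_contDiff_two {a b : ℝ → ℝ} (ha : ContDiff ℝ 2 a) (hb : ContDiff ℝ 2 b)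
    (x : ℝ) : deriv (fun y => a y - b y) x = deriv a x - deriv b x ∧
      deriv (deriv fun y => a y - b y) x = deriv (deriv a) x - deriv (deriv b) x := by
  have h : ∀ {a : ℝ → ℝ}, ContDiff ℝ 2 a → Differentiable ℝ (deriv a) := fun {a} ha => by
    have h : ContDiff ℝ (1 + 1) a := by rw [one_add_one_eq_two]; exact ha
    exact (contDiff_one_iff_deriv.1 (contDiff_succ_iff_deriv.1 h).2.2).1
  have e : (deriv fun y => a y - b y) = fun y => deriv a y - deriv b y := by
    funext y
    exact deriv_fun_sub (ha.differentiable two_ne_zero y) (hb.differentiable two_ne_zero y)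
  exact ⟨congrFun e x, by rw [e]; exact deriv_fun_sub (h ha x) (h hb x)⟩

lemma deriv_deriv_sum_of_contDiff_two {ι : Type*} [Fintype ι] {a : ι → ℝ → ℝ}
    (ha : ∀ n, ContDiff ℝ 2 (a n)) (x : ℝ) :
    deriv (fun y => ∑ n, a n y) x = ∑ n, deriv (a n) x ∧
      deriv (deriv fun y => ∑ n, a n y) x = ∑ n, deriv (deriv (a n)) x := by
  have h : ∀ n, Differentiable ℝ (deriv (a n)) := fun n => by
    have h : ContDiff ℝ (1 + 1) (a n) := by rw [one_add_one_eq_two]; exact ha n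
    exact (contDiff_one_iff_deriv.1 (contDiff_succ_iff_deriv.1 h).2.2).1
  have e : (deriv fun y => ∑ n, a n y) = fun y => ∑ n, deriv (a n) y := by
    funext y
    exact deriv_fun_sum fun n _ => (ha n).differentiable two_ne_zero y
  exact ⟨congrFun e x, by rw [e]; exact deriv_fun_sum fun n _ => h n x⟩

/-- The space derivative of a coefficient with bounded gradient is bounded. -/
lemma exists_abs_deriv_le {σ : ℝ → ℝ → ℝ}
    (hσ : ContDiff ℝ (⊤ : ℕ∞) (fun q : ℝ × ℝ => σ q.1 q.2))
    (hσbdd : ∃ C : ℝ, ∀ q : ℝ × ℝ,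
      ‖iteratedFDeriv ℝ 1 (fun q : ℝ × ℝ => σ q.1 q.2) q‖ ≤ C) :
    ∃ C : ℝ, 0 ≤ C ∧ ∀ t x, |deriv (σ t) x| ≤ C := by
  obtain ⟨C, hC⟩ := hσbdd
  refine ⟨C, (norm_nonneg _).trans (hC 0), fun t x => ?_⟩
  have h1 : HasFDerivAt (fun q : ℝ × ℝ => σ q.1 q.2)
      (fderiv ℝ (fun q : ℝ × ℝ => σ q.1 q.2) (t, x)) (t, x) :=
    (hσ.differentiable (by simp) _).hasFDerivAt
  have h2 : HasDerivAt (fun y : ℝ => (t, y)) ((0 : ℝ), (1 : ℝ)) x :=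
    (hasDerivAt_const x t).prodMk (hasDerivAt_id x)
  have h3 : deriv (σ t) x = fderiv ℝ (fun q : ℝ × ℝ => σ q.1 q.2) (t, x) (0, 1) :=
    (h1.comp_hasDerivAt x h2).deriv
  rw [h3, ← Real.norm_eq_abs]
  refine (ContinuousLinearMap.le_opNorm _ _).trans ?_
  rw [← norm_iteratedFDeriv_one]
  simpa using hC (t, x)

/-- A conserved linear combination: the difference of total densities of two solutions vanishes. -/
lemma sum_eq_of_isSPDESolution {N : ℕ} {f : Fin N → ℝ} (hf : ∀ n, 0 < f n)
    {T ε γ : ℝ} (hT : 0 < T) (hε : 0 < ε) (hγ : 0 < γ) {σ : ℝ → ℝ → ℝ} {σ₀ σ₁ σ' : ℝ}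
    (hσ₀ : 0 < σ₀) (hσ' : 0 ≤ σ') (hσd : ∀ t, ContDiff ℝ 2 (σ t))
    (hσbound : ∀ t x : ℝ, σ₀ ≤ σ t x ∧ σ t x ≤ σ₁) (hσ'bound : ∀ t x, |deriv (σ t) x| ≤ σ')
    {m : Fin N → ℝ} {P : Fin N → ℝ → ℝ} {p q : Fin N → ℝ → ℝ → ℝ}
    (hp : ∀ n, MemParabHolder γ T (p n)) (hq : ∀ n, MemParabHolder γ T (q n))
    (hpsol : IsSPDESolution N f ε T σ m P p) (hqsol : IsSPDESolution N f ε T σ m P q) :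
    ∀ t ∈ Set.Icc (0 : ℝ) T, ∀ x : ℝ, ∑ n, p n t x = ∑ n, q n t x := by
  obtain ⟨Kp, hKp, hpb⟩ := MemParabHolder.exists_bound hp
  obtain ⟨Kq, hKq, hqb⟩ := MemParabHolder.exists_bound hq
  have hpd := fun n t (ht : t ∈ Set.Icc 0 T) => (hp n).contDiff_two hγ ht
  have hqd := fun n t (ht : t ∈ Set.Icc 0 T) => (hq n).contDiff_two hγ ht
  have hp0 := fun n t (ht : t ∈ Set.Icc 0 T) => (hpsol.1 n t ht).1
  have hq0 := fun n t (ht : t ∈ Set.Icc 0 T) => (hqsol.1 n t ht).1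
  have hσ₁ : 0 ≤ σ₁ := hσ₀.le.trans ((hσbound 0 0).1.trans (hσbound 0 0).2)
  have hudiff : ∀ t ∈ Set.Icc 0 T, Differentiable ℝ fun x => ∑ n, (p n t x - q n t x) :=
    fun t ht => Differentiable.fun_sum fun n _ => ((hpd n t ht).differentiable two_ne_zero).sub
      ((hqd n t ht).differentiable two_ne_zero)
  have hut : ∀ t ∈ Set.Icc 0 T, ∀ x, HasDerivAt (fun s => ∑ n, (p n s x - q n s x))
      (∑ n, (deriv (fun s => p n s x) t - deriv (fun s => q n s x) t)) t := fun t ht x =>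
    HasDerivAt.fun_sum fun n _ => (((hp n).1 t ht x).2.2.hasDerivAt).sub
      ((hq n).1 t ht x).2.2.hasDerivAt
  have hux : ∀ t ∈ Set.Icc 0 T, ∀ x, deriv (fun x => ∑ n, (p n t x - q n t x)) x =
      ∑ n, (deriv (p n t) x - deriv (q n t) x) := fun t ht x =>
    (HasDerivAt.fun_sum fun n _ => (((hp n).1 t ht x).1.hasDerivAt).sub
      ((hq n).1 t ht x).1.hasDerivAt).deriv
  have hsum : ∀ a b : Fin N → ℝ, (∀ n, |a n| ≤ Kp) → (∀ n, |b n| ≤ Kq) →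
      |∑ n, (a n - b n)| ≤ N * (Kp + Kq) := fun a b ha hb => by
    refine (Finset.abs_sum_le_sum_abs _ _).trans ?_
    have := Finset.sum_le_card_nsmul Finset.univ (fun n => |a n - b n|) (Kp + Kq)
      fun n _ => (abs_sub _ _).trans (add_le_add (ha n) (hb n))
    simpa only [nsmul_eq_mul, Finset.card_univ, Fintype.card_fin] using this
  have hflux : ∀ t ∈ Set.Icc 0 T,
      (fun x => ∑ n, (spdeFlux N f ε σ p n t x - spdeFlux N f ε σ q n t x)) =
      fun x => σ t x ^ 2 * ∑ n, (p n t x - q n t x) := fun t ht => by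
    funext x
    rw [Finset.sum_sub_distrib, sum_spdeFlux hf hε fun n => hp0 n t ht,
      sum_spdeFlux hf hε fun n => hq0 n t ht, Finset.sum_sub_distrib, mul_sub]
  have hpf := fun n t (ht : t ∈ Set.Icc 0 T) => contDiff_spdeFlux hf hε (hσd t)
    (fun n => hp0 n t ht) (fun n => hpd n t ht) n
  have hqf := fun n t (ht : t ∈ Set.Icc 0 T) => contDiff_spdeFlux hf hε (hσd t)
    (fun n => hq0 n t ht) (fun n => hqd n t ht) n
  have key := eq_zero_of_coercive (ι := Unit) (K := N * (Kp + Kq)) (c := σ₀ ^ 2)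
    (C := 2 * σ₁ * σ' + σ₁ ^ 2) hT (by positivity) (by positivity)
    (fun _ t x => ∑ n, (p n t x - q n t x))
    (fun _ t x => ∑ n, (spdeFlux N f ε σ p n t x - spdeFlux N f ε σ q n t x))
    (fun _ t x => σ t x ^ 2 * deriv (fun x => ∑ n, (p n t x - q n t x)) x)
    (fun _ => hudiff) (fun _ t ht x => (hut t ht x).differentiableAt)
    (fun _ t ht => ContDiff.sum fun n _ => (hpf n t ht).sub (hqf n t ht)) ?_ ?_ ?_ ?_ ?_ ?_
  · intro t ht x
    have := key () t ht x
    rw [Finset.sum_sub_distrib] at this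
    exact sub_eq_zero.1 this
  · refine fun _ t ht x => ⟨hsum _ _ (fun n => (hpb n t ht x).1) fun n => (hqb n t ht x).1, ?_, ?_⟩
    · rw [hux t ht x]
      exact hsum _ _ (fun n => (hpb n t ht x).2.1) fun n => (hqb n t ht x).2.1
    · rw [(hut t ht x).deriv]
      exact hsum _ _ (fun n => (hpb n t ht x).2.2) fun n => (hqb n t ht x).2.2
  · intro _ t ht x
    rw [(hut t ht x).deriv]
    obtain ⟨h1, h2⟩ := deriv_deriv_sum_of_contDiff_two
      (fun n => (hpf n t ht).sub (hqf n t ht)) x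
    rw [h1, h2, Finset.mul_sum, Finset.mul_sum, ← Finset.sum_add_distrib]
    refine Finset.sum_congr rfl fun n _ => ?_
    obtain ⟨h3, h4⟩ := deriv_deriv_sub_of_contDiff_two (hpf n t ht) (hqf n t ht) x
    rw [h3, h4, hpsol.2.2 n t ht x, hqsol.2.2 n t ht x]
    change _ * deriv (deriv (spdeFlux N f ε σ p n t)) x + _ * deriv (spdeFlux N f ε σ p n t) x -
      (_ * deriv (deriv (spdeFlux N f ε σ q n t)) x + _ * deriv (spdeFlux N f ε σ q n t) x) = _
    ring
  · intro _ x
    simp [hpsol.2.1, hqsol.2.1]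
  · intro _ t ht x
    have hσa : |σ t x| ≤ σ₁ := abs_le.2 ⟨by linarith [(hσbound t x).1], (hσbound t x).2⟩
    have h : deriv (fun x => σ t x ^ 2 * ∑ n, (p n t x - q n t x)) x =
        2 * σ t x * deriv (σ t) x * ∑ n, (p n t x - q n t x) +
          σ t x ^ 2 * deriv (fun x => ∑ n, (p n t x - q n t x)) x := by
      have := ((((hσd t).differentiable two_ne_zero x).hasDerivAt.pow 2).mul
        (hudiff t ht x).hasDerivAt).deriv
      refine this.trans ?_
      simp
    simp only [hflux t ht]
    rw [h, add_sub_cancel_right, Finset.univ_unique (α := Unit), Finset.sum_singleton]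
    refine (abs_mul_le_of_abs_le (abs_mul_le_of_abs_le (abs_mul_le_of_abs_le abs_two.le hσa)
      (hσ'bound t x)) le_rfl).trans (mul_le_mul_of_nonneg_right ?_ (abs_nonneg _))
    exact le_add_of_nonneg_right (sq_nonneg _)
  · intro _ t ht x
    have hσa : |σ t x| ≤ σ₁ := abs_le.2 ⟨by linarith [(hσbound t x).1], (hσbound t x).2⟩
    rw [Finset.univ_unique (α := Unit), Finset.sum_singleton, abs_mul, abs_pow]
    refine mul_le_mul_of_nonneg_right ?_ (abs_nonneg _)
    have := pow_le_pow_left₀ (abs_nonneg _) hσa 2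
    have h2 : 0 ≤ 2 * σ₁ * σ' := by positivity
    linarith
  · intro t ht x
    simp only [Finset.univ_unique, Finset.sum_singleton]
    have := pow_le_pow_left₀ hσ₀.le (hσbound t x).1 2
    nlinarith [sq_nonneg (deriv (fun x => ∑ n, (p n t x - q n t x)) x)]

/-- Uniqueness (Proposition 2.6): under Condition (C), two solutions of (SPDE) in
`(C^{1+α/4,2+α/2})^N` with the same initial data and masses coincide on `[0,T]×ℝ`. -/
theorem SPDE_uniqueness (N : ℕ) (hN : 2 ≤ N) (f : Fin N → ℝ) (hf : ∀ n, 0 < f n)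
    (hC : min (kappa0 N f) 1 > betaf N f)
    (T ε α : ℝ) (hT : 0 < T) (hε : 0 < ε) (hα : α ∈ Set.Ioo (0 : ℝ) 1)
    (σ : ℝ → ℝ → ℝ) (σ₀ σ₁ : ℝ) (hσ₀ : 0 < σ₀)
    (hσsmooth : ContDiff ℝ (⊤ : ℕ∞) (fun q : ℝ × ℝ => σ q.1 q.2))
    (hσbdd : ∀ k : ℕ, ∃ C : ℝ, ∀ q : ℝ × ℝ,
      ‖iteratedFDeriv ℝ k (fun q : ℝ × ℝ => σ q.1 q.2) q‖ ≤ C)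
    (hσbound : ∀ t x : ℝ, σ₀ ≤ σ t x ∧ σ t x ≤ σ₁)
    (m : Fin N → ℝ) (hm : ∀ n, 0 ≤ m n) (hmsum : ∑ n, m n = 1)
    (P : Fin N → ℝ → ℝ) (p q : Fin N → ℝ → ℝ → ℝ)
    (hp : ∀ n, MemParabHolder (α / 2) T (p n))
    (hq : ∀ n, MemParabHolder (α / 2) T (q n))
    (hpsol : IsSPDESolution N f ε T σ m P p)
    (hqsol : IsSPDESolution N f ε T σ m P q) :
    ∀ n, ∀ t ∈ Set.Icc (0 : ℝ) T, ∀ x : ℝ, p n t x = q n t x := by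
  have hγ : 0 < α / 2 := half_pos hα.1
  obtain ⟨σ', hσ', hσ'bound⟩ := exists_abs_deriv_le hσsmooth (hσbdd 1)
  have hσd : ∀ t, ContDiff ℝ 2 (σ t) := fun t =>
    (contDiff_infty.1 hσsmooth 2).comp (contDiff_const.prodMk contDiff_id)
  have hS := sum_eq_of_isSPDESolution hf hT hε hγ hσ₀ hσ' hσd hσbound hσ'bound hp hq hpsol hqsol
  obtain ⟨hsqrt, hdev⟩ := condition_consequences hN hf hC
  obtain ⟨Kp, hKp, hpb⟩ := MemParabHolder.exists_bound hp
  obtain ⟨Kq, hKq, hqb⟩ := MemParabHolder.exists_bound hq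
  have hpd := fun n t (ht : t ∈ Set.Icc 0 T) => (hp n).contDiff_two hγ ht
  have hqd := fun n t (ht : t ∈ Set.Icc 0 T) => (hq n).contDiff_two hγ ht
  have hp0 := fun n t (ht : t ∈ Set.Icc 0 T) => (hpsol.1 n t ht).1
  have hq0 := fun n t (ht : t ∈ Set.Icc 0 T) => (hqsol.1 n t ht).1
  have hσ₁ : 0 ≤ σ₁ := hσ₀.le.trans ((hσbound 0 0).1.trans (hσbound 0 0).2)
  have hpf := fun n t (ht : t ∈ Set.Icc 0 T) => contDiff_spdeFlux hf hε (hσd t)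
    (fun n => hp0 n t ht) (fun n => hpd n t ht) n
  have hqf := fun n t (ht : t ∈ Set.Icc 0 T) => contDiff_spdeFlux hf hε (hσd t)
    (fun n => hq0 n t ht) (fun n => hqd n t ht) n
  have hux : ∀ n, ∀ t ∈ Set.Icc 0 T, ∀ x, deriv (fun x => p n t x - q n t x) x =
      deriv (p n t) x - deriv (q n t) x := fun n t ht x =>
    deriv_fun_sub ((hp n).1 t ht x).1 ((hq n).1 t ht x).1
  have hut : ∀ n, ∀ t ∈ Set.Icc 0 T, ∀ x, HasDerivAt (fun s => p n s x - q n s x)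
      (deriv (fun s => p n s x) t - deriv (fun s => q n s x) t) t := fun n t ht x =>
    ((hp n).1 t ht x).2.2.hasDerivAt.sub ((hq n).1 t ht x).2.2.hasDerivAt
  have hS' : ∀ t ∈ Set.Icc 0 T, ∀ x, ∑ k, deriv (p k t) x = ∑ k, deriv (q k t) x := by
    intro t ht x
    have h := congrArg (fun g : ℝ → ℝ => deriv g x) (funext (hS t ht))
    simpa only [(deriv_deriv_sum_of_contDiff_two (fun n => hpd n t ht) x).1,
      (deriv_deriv_sum_of_contDiff_two (fun n => hqd n t ht) x).1] using h
  obtain ⟨Φ, hΦ⟩ : ∃ Φ, Φ = ∑ k, f k := ⟨_, rfl⟩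
  have hΦ0 : 0 ≤ Φ := hΦ ▸ Finset.sum_nonneg fun n _ => (hf n).le
  have hfΦ : ∀ n, f n ≤ Φ := fun n => hΦ ▸
    Finset.single_le_sum (fun k _ => (hf k).le) (Finset.mem_univ n)
  have hfabs : ∀ n, |f n| ≤ Φ := fun n => by rw [abs_of_pos (hf n)]; exact hfΦ n
  obtain ⟨K, hK⟩ : ∃ K, K = Kp + Kq + σ₁ + σ' + ε + Φ * (N * (Kp + Kq)) + Φ + ε⁻¹ := ⟨_, rfl⟩
  have hsum : ∀ {M : ℝ} {a : Fin N → ℝ}, (∀ n, |a n| ≤ M) → ∑ n, |a n| ≤ N * M := by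
    intro M a ha
    simpa using Finset.sum_le_card_nsmul Finset.univ (fun n => |a n|) M fun n _ => ha n
  have hNK : 0 ≤ Φ * (N * (Kp + Kq)) := by positivity
  have hε' : 0 < ε⁻¹ := inv_pos.2 hε
  have hNp : (N : ℝ) * Kp ≤ N * (Kp + Kq) :=
    mul_le_mul_of_nonneg_left (le_add_of_nonneg_right hKq) (Nat.cast_nonneg _)
  have hNq : (N : ℝ) * Kq ≤ N * (Kp + Kq) :=
    mul_le_mul_of_nonneg_left (le_add_of_nonneg_left hKp) (Nat.cast_nonneg _)
  have hK0 : 0 < K := by rw [hK]; positivity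
  have hinv : ∀ {r : Fin N → ℝ → ℝ → ℝ} {t : ℝ}, (∀ n x, 0 ≤ r n t x) → ∀ x,
      |(ε + ∑ k, f k * r k t x)⁻¹| ≤ K := by
    intro r t hr x
    have h := le_Bfun_denom (ε := ε) hf hr x
    rw [abs_of_pos (inv_pos.2 (hε.trans_le h))]
    refine (inv_anti₀ hε h).trans ?_
    linarith
  have hlin : ∀ {a : Fin N → ℝ}, (∀ n, |a n| ≤ Kp) → ∀ n,
      |f n * ∑ k, a k| ≤ Φ * (N * (Kp + Kq)) := fun ha n =>
    abs_mul_le_of_abs_le (hfabs n)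
      ((Finset.abs_sum_le_sum_abs _ _).trans ((hsum ha).trans hNp))
  have key := eq_zero_of_coercive (K := Kp + Kq) (c := σ₀ ^ 2 * K⁻¹ ^ 2 * ε ^ 2)
    (C := (3 * K ^ 3 * (K + K ^ 4) + K ^ 3 * (K ^ 4 + K ^ 3 + 2 * K ^ 6)) + K ^ 3 * (K + K ^ 4)) hT
    (by positivity) (by positivity)
    (fun n t x => p n t x - q n t x)
    (fun n t x => spdeFlux N f ε σ p n t x - spdeFlux N f ε σ q n t x)
    (fun n t x => σ t x ^ 2 * (ε + f n * ∑ k, p k t x) *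
      (deriv (fun x => p n t x - q n t x) x * (ε + ∑ k, f k * p k t x)⁻¹ -
        p n t x * (∑ k, f k * deriv (fun x => p k t x - q k t x) x) *
          (ε + ∑ k, f k * p k t x)⁻¹ ^ 2))
    (fun n t ht => ((hpd n t ht).differentiable two_ne_zero).sub
      ((hqd n t ht).differentiable two_ne_zero))
    (fun n t ht x => (hut n t ht x).differentiableAt)
    (fun n t ht => (hpf n t ht).sub (hqf n t ht)) ?_ ?_ ?_ ?_ ?_ ?_
  · exact fun n t ht x => sub_eq_zero.1 (key n t ht x)
  · intro n t ht x
    rw [hux n t ht x, (hut n t ht x).deriv]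
    obtain ⟨h1, h2, h3⟩ := hpb n t ht x
    obtain ⟨h4, h5, h6⟩ := hqb n t ht x
    exact ⟨(abs_sub _ _).trans (add_le_add h1 h4), (abs_sub _ _).trans (add_le_add h2 h5),
      (abs_sub _ _).trans (add_le_add h3 h6)⟩
  · intro n t ht x
    rw [(hut n t ht x).deriv]
    obtain ⟨h3, h4⟩ := deriv_deriv_sub_of_contDiff_two (hpf n t ht) (hqf n t ht) x
    rw [h3, h4, hpsol.2.2 n t ht x, hqsol.2.2 n t ht x]
    change _ * deriv (deriv (spdeFlux N f ε σ p n t)) x + _ * deriv (spdeFlux N f ε σ p n t) x -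
      (_ * deriv (deriv (spdeFlux N f ε σ q n t)) x + _ * deriv (spdeFlux N f ε σ q n t) x) = _
    ring
  · intro n x
    simp [hpsol.2.1, hqsol.2.1]
  · intro n t ht x
    have hDp := (hε.trans_le (le_Bfun_denom hf (fun n => hp0 n t ht) x)).ne'
    have hDq := (hε.trans_le (le_Bfun_denom hf (fun n => hq0 n t ht) x)).ne'
    have hσa : |σ t x| ≤ σ₁ := abs_le.2 ⟨by linarith [(hσbound t x).1], (hσbound t x).2⟩
    have hF : ∑ k, f k * p k t x - ∑ k, f k * q k t x = ∑ k, f k * (p k t x - q k t x) := by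
      simp only [mul_sub, Finset.sum_sub_distrib]
    have hR := abs_flux_remainder_le (p := p n t x) (q := q n t x) (q' := deriv (q n t) x)
      (s := σ t x) (s' := deriv (σ t) x) (g := ε + f n * ∑ k, p k t x)
      (g' := f n * ∑ k, deriv (p k t) x) (i := (ε + ∑ k, f k * p k t x)⁻¹)
      (j := (ε + ∑ k, f k * q k t x)⁻¹) (Fq' := ∑ k, f k * deriv (q k t) x)
      (Z := ∑ k, f k * (p k t x - q k t x)) (K := K) (V := ∑ k, |p k t x - q k t x|)
      (by linarith [(hqb n t ht x).1])
      (by linarith [(hqb n t ht x).2.1]) (by linarith) (by linarith [hσ'bound t x])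
      ((abs_add_le _ _).trans (by
        rw [abs_of_pos hε]; linarith [hlin (fun n => (hpb n t ht x).1) n]))
      (by linarith [hlin (fun n => (hpb n t ht x).2.1) n])
      (hinv (fun n => hp0 n t ht) x) (hinv (fun n => hq0 n t ht) x)
      ((abs_sum_mul_le hfabs).trans (by
        have h1 := hsum (fun n => (hqb n t ht x).2.1)
        have h2 := mul_le_mul_of_nonneg_left (h1.trans hNq) hΦ0
        linarith))
      (by rw [← hF]; field_simp; ring)
      ((abs_sum_mul_le hfabs).trans (mul_le_mul_of_nonneg_right (by linarith)
        (Finset.sum_nonneg fun _ _ => abs_nonneg _)))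
      (Finset.single_le_sum (f := fun k => |p k t x - q k t x|) (fun _ _ => abs_nonneg _)
        (Finset.mem_univ n))
    have hF' : ∑ k, f k * deriv (fun x => p k t x - q k t x) x =
        ∑ k, f k * deriv (p k t) x - ∑ k, f k * deriv (q k t) x := by
      simp only [fun k => hux k t ht x, mul_sub, Finset.sum_sub_distrib]
    rw [(deriv_deriv_sub_of_contDiff_two (hpf n t ht) (hqf n t ht) x).1,
      deriv_spdeFlux hf hε ((hσd t).differentiable two_ne_zero) (fun n => hp0 n t ht)
        (fun n => (hpd n t ht).differentiable two_ne_zero),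
      deriv_spdeFlux hf hε ((hσd t).differentiable two_ne_zero) (fun n => hq0 n t ht)
        (fun n => (hqd n t ht).differentiable two_ne_zero), ← hS t ht, ← hS' t ht, hF', hux n t ht x]
    refine le_trans (le_of_eq ?_) (hR.trans (mul_le_mul_of_nonneg_right
      (le_add_of_nonneg_right (by positivity)) (Finset.sum_nonneg fun _ _ => abs_nonneg _)))
    congr 1
    ring
  · intro n t ht x
    have hσa : |σ t x| ≤ σ₁ := abs_le.2 ⟨by linarith [(hσbound t x).1], (hσbound t x).2⟩
    refine (abs_flux_principal_le (K := K) (V := ∑ k, |deriv (fun x => p k t x - q k t x) x|)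
      (by linarith [(hpb n t ht x).1]) (by linarith)
      ((abs_add_le _ _).trans (by
        rw [abs_of_pos hε]; linarith [hlin (fun n => (hpb n t ht x).1) n]))
      (hinv (fun n => hp0 n t ht) x)
      ((abs_sum_mul_le hfabs).trans (mul_le_mul_of_nonneg_right (by linarith)
        (Finset.sum_nonneg fun _ _ => abs_nonneg _)))
      (Finset.single_le_sum (f := fun k => |deriv (fun x => p k t x - q k t x) x|)
        (fun _ _ => abs_nonneg _) (Finset.mem_univ n))).trans (mul_le_mul_of_nonneg_right
      (le_add_of_nonneg_left (by positivity)) (Finset.sum_nonneg fun _ _ => abs_nonneg _))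
  · intro t ht x
    have hD := hε.trans_le (le_Bfun_denom hf (fun n => hp0 n t ht) x)
    have hξ : ∑ k, deriv (fun x => p k t x - q k t x) x = 0 := by
      simp only [fun k => hux k t ht x, Finset.sum_sub_distrib, hS' t ht x, sub_self]
    have hJ := jacobian_coercive hN hf hε.le hsqrt hdev (fun n => hp0 n t ht x) hξ
    have hDK : ε + ∑ k, f k * p k t x ≤ K := by
      have h1 := (le_abs_self _).trans (abs_sum_mul_le (a := f) (b := fun k => p k t x) hfabs)
      have h2 := mul_le_mul_of_nonneg_left ((hsum fun n => (hpb n t ht x).1).trans hNp) hΦ0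
      linarith
    have h1 : K⁻¹ ^ 2 ≤ (ε + ∑ k, f k * p k t x)⁻¹ ^ 2 :=
      pow_le_pow_left₀ (inv_pos.2 hK0).le (inv_anti₀ hD hDK) 2
    have h2 := pow_le_pow_left₀ hσ₀.le (hσbound t x).1 2
    have hX : 0 ≤ ∑ n, deriv (fun x => p n t x - q n t x) x ^ 2 :=
      Finset.sum_nonneg fun _ _ => sq_nonneg _
    calc σ₀ ^ 2 * K⁻¹ ^ 2 * ε ^ 2 * ∑ n, deriv (fun x => p n t x - q n t x) x ^ 2
        = σ₀ ^ 2 * K⁻¹ ^ 2 * (ε ^ 2 * ∑ n, deriv (fun x => p n t x - q n t x) x ^ 2) := by ring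
      _ ≤ σ t x ^ 2 * (ε + ∑ k, f k * p k t x)⁻¹ ^ 2 *
          (ε ^ 2 * ∑ n, deriv (fun x => p n t x - q n t x) x ^ 2) :=
        mul_le_mul_of_nonneg_right (mul_le_mul h2 h1 (by positivity) (by positivity))
          (by positivity)
      _ ≤ _ := mul_le_mul_of_nonneg_left hJ (by positivity)
      _ = _ := by
        rw [Finset.mul_sum]
        refine Finset.sum_congr rfl fun n _ => ?_
        field_simp
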